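/- Let d ≥ 1, let Σ be a symmetric positive-definite d×d real matrix with symmetric square root Σ^{1/2}, and let 𝔣 : (0,∞) → [0,∞) be Borel measurable with 0 < μ := ∫_0^∞ r^{d−1} 𝔣(r) dr < ∞. Let κ := ∫_{ℝ^d} 𝔣(‖x‖) dx (finite), and let Z be a random vector with the elliptical density f(z) := κ^{−1} (det Σ)^{−1/2} 𝔣(‖Σ^{−1/2} z‖). Define the radial distribution function F*(r) := μ^{−1} ∫_0^r s^{d−1} 𝔣(s) ds. Then the pushforward of the law of Z under the map z ↦ F*(‖Σ^{−1/2} z‖) · Σ^{−1/2} z / ‖Σ^{−1/2} z‖ (with 0 mapped to 0) equals the spherical uniform distribution U_d. -/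

import Mathlib

open MeasureTheory
open scoped BigOperators

/-- The uniform (normalized surface) probability measure on the unit sphere `S^{d-1}` of `ℝ^d`,
viewed as a measure on the ambient space `ℝ^d`. -/
noncomputable def unitSphereUniform (d : ℕ) : Measure (EuclideanSpace ℝ (Fin d)) :=
  Measure.map (Subtype.val)
    ((((volume : Measure (EuclideanSpace ℝ (Fin d))).toSphere) Set.univ)⁻¹ •
      (volume : Measure (EuclideanSpace ℝ (Fin d))).toSphere)

/-- The spherical uniform distribution `U_d` on `ℝ^d`: the pushforward of
(uniform on `[0,1]`) ⊗ (uniform on the unit sphere) under `(r, u) ↦ r • u`. -/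
noncomputable def sphericalUniform (d : ℕ) : Measure (EuclideanSpace ℝ (Fin d)) :=
  Measure.map (fun p : ℝ × EuclideanSpace ℝ (Fin d) => p.1 • p.2)
    (((volume : Measure ℝ).restrict (Set.Icc (0:ℝ) 1)).prod (unitSphereUniform d))

/-- Action of a `d×d` matrix on a vector of `ℝ^d` (Euclidean space). -/
noncomputable def matVec {d : ℕ} (A : Matrix (Fin d) (Fin d) ℝ)
    (v : EuclideanSpace ℝ (Fin d)) : EuclideanSpace ℝ (Fin d) :=
  (EuclideanSpace.equiv (Fin d) ℝ).symm (A.mulVec (EuclideanSpace.equiv (Fin d) ℝ v))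

open ProbabilityTheory Filter Topology

/-- Integration in polar coordinates with respect to an additive Haar measure. -/
theorem lintegral_eq_lintegral_toSphere_Ioi {E : Type*} [NormedAddCommGroup E] [NormedSpace ℝ E]
    [FiniteDimensional ℝ E] [Nontrivial E] [MeasurableSpace E] [BorelSpace E] (μ : Measure E)
    [μ.IsAddHaarMeasure] {g : E → ENNReal} (hg : Measurable g) :
    ∫⁻ x, g x ∂μ = ∫⁻ u : Metric.sphere (0 : E) 1, (∫⁻ r in Set.Ioi (0 : ℝ),
      ENNReal.ofReal (r ^ (Module.finrank ℝ E - 1)) * g (r • (u : E))) ∂μ.toSphere := by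
  calc
    ∫⁻ x, g x ∂μ = ∫⁻ x : ({(0)}ᶜ : Set E), g x ∂(μ.comap (↑)) := by
      rw [lintegral_subtype_comap (measurableSet_singleton _).compl g,
        restrict_compl_singleton]
    _ = ∫⁻ p : Metric.sphere (0 : E) 1 × Set.Ioi (0 : ℝ), g ((p.2 : ℝ) • (p.1 : E))
          ∂μ.toSphere.prod (.volumeIoiPow (Module.finrank ℝ E - 1)) := by
      rw [← μ.measurePreserving_homeomorphUnitSphereProd.lintegral_comp_emb
        (Homeomorph.measurableEmbedding _)]
      refine lintegral_congr fun x => ?_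
      have hx : ‖(x : E)‖ ≠ 0 := norm_ne_zero_iff.2 x.2
      simp [smul_smul, hx]
    _ = ∫⁻ u : Metric.sphere (0 : E) 1, ∫⁻ r : Set.Ioi (0 : ℝ), g ((r : ℝ) • (u : E))
          ∂(.volumeIoiPow (Module.finrank ℝ E - 1)) ∂μ.toSphere := by
      rw [lintegral_prod]
      exact (hg.comp (by fun_prop)).aemeasurable
    _ = _ := by
      refine lintegral_congr fun u => ?_
      rw [Measure.volumeIoiPow, lintegral_withDensity_eq_lintegral_mul _ (by fun_prop)
        (by fun_prop)]
      exact lintegral_subtype_comap measurableSet_Ioi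
        fun r : ℝ => ENNReal.ofReal (r ^ (Module.finrank ℝ E - 1)) * g (r • (u : E))

theorem continuous_cdf (ν : Measure ℝ) [IsProbabilityMeasure ν] [NullSingletonClass ν] :
    Continuous (cdf ν) := by
  refine continuous_iff_continuousAt.2 fun x => ?_
  rw [(monotone_cdf ν).continuousAt_iff_leftLim_eq_rightLim, (cdf ν).rightLim_eq]
  have h := (cdf ν).measure_singleton x
  rw [measure_cdf, measure_singleton, eq_comm, ENNReal.ofReal_eq_zero, sub_nonpos] at h
  exact le_antisymm ((monotone_cdf ν).leftLim_le le_rfl) h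

/-- The probability integral transform: an atomless law is pushed forward to the uniform law
on `[0, 1]` by its distribution function. -/
theorem map_cdf_eq_restrict_Icc (ν : Measure ℝ) [IsProbabilityMeasure ν] [NullSingletonClass ν] :
    ν.map (cdf ν) = (volume : Measure ℝ).restrict (Set.Icc 0 1) := by
  have hmeas : Measurable (cdf ν) := (monotone_cdf ν).measurable
  have : IsProbabilityMeasure (ν.map (cdf ν)) := Measure.isProbabilityMeasure_map hmeas.aemeasurable
  have hex : ∀ t ∈ Set.Ioo (0 : ℝ) 1, ∃ x, cdf ν x = t := fun t ht =>
    mem_range_of_exists_le_of_exists_ge (continuous_cdf ν)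
      ((tendsto_cdf_atBot ν).eventually (eventually_le_nhds ht.1)).exists
      ((tendsto_cdf_atTop ν).eventually (eventually_ge_nhds ht.2)).exists
  have hlower : ∀ t ∈ Set.Ioo (0 : ℝ) 1, ENNReal.ofReal t ≤ ν (cdf ν ⁻¹' Set.Iic t) := by
    intro t ht
    obtain ⟨x, rfl⟩ := hex t ht
    rw [ofReal_cdf]
    exact measure_mono fun y hy => monotone_cdf ν hy
  have hupper : ∀ t ∈ Set.Ico (0 : ℝ) 1, ν (cdf ν ⁻¹' Set.Iic t) ≤ ENNReal.ofReal t := by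
    intro t ht
    have hlim : Tendsto ENNReal.ofReal (𝓝[>] t) (𝓝 (ENNReal.ofReal t)) :=
      ENNReal.continuous_ofReal.continuousAt.tendsto.mono_left nhdsWithin_le_nhds
    refine ge_of_tendsto hlim ?_
    filter_upwards [Ioo_mem_nhdsGT ht.2] with s hs
    obtain ⟨x, rfl⟩ := hex s ⟨ht.1.trans_lt hs.1, hs.2⟩
    rw [ofReal_cdf]
    refine measure_mono fun y hy => ?_
    by_contra hxy
    exact (hs.1.trans_le (monotone_cdf ν (not_le.1 hxy).le)).not_ge hy
  refine Measure.ext_of_Iic _ _ fun t => ?_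
  rw [Measure.map_apply hmeas measurableSet_Iic, Measure.restrict_apply measurableSet_Iic]
  rcases lt_or_ge t 0 with ht0 | ht0
  · have h1 : cdf ν ⁻¹' Set.Iic t = ∅ :=
      Set.eq_empty_of_forall_notMem fun y hy => (ht0.trans_le (cdf_nonneg ν y)).not_ge hy
    have h2 : Set.Iic t ∩ Set.Icc 0 1 = ∅ :=
      Set.eq_empty_of_forall_notMem fun y hy => (ht0.trans_le hy.2.1).not_ge hy.1
    simp [h1, h2]
  rcases lt_or_ge t 1 with ht1 | ht1
  · have h2 : Set.Iic t ∩ Set.Icc 0 1 = Set.Icc 0 t :=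
      Set.ext fun y => ⟨fun h => ⟨h.2.1, h.1⟩, fun h => ⟨h.2, h.1, h.2.trans ht1.le⟩⟩
    rw [h2, Real.volume_Icc, sub_zero]
    refine le_antisymm (hupper t ⟨ht0, ht1⟩) ?_
    rcases ht0.eq_or_lt with rfl | ht0
    · simp
    · exact hlower t ⟨ht0, ht1⟩
  · have h1 : cdf ν ⁻¹' Set.Iic t = Set.univ :=
      Set.eq_univ_of_forall fun y => (cdf_le_one ν y).trans ht1
    have h2 : Set.Iic t ∩ Set.Icc 0 1 = Set.Icc 0 1 :=
      Set.inter_eq_right.2 fun y hy => hy.2.trans ht1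
    simp [h1, h2]

theorem matVec_eq_toEuclideanLin {d : ℕ} (A : Matrix (Fin d) (Fin d) ℝ) :
    matVec A = Matrix.toEuclideanLin A := rfl

theorem measurable_matVec {d : ℕ} (A : Matrix (Fin d) (Fin d) ℝ) : Measurable (matVec A) := by
  rw [matVec_eq_toEuclideanLin]
  exact (LinearMap.continuous_of_finiteDimensional _).measurable

theorem lintegral_comp_matVec_inv {d : ℕ} {A : Matrix (Fin d) (Fin d) ℝ} (hA : A.det ≠ 0)
    {g : EuclideanSpace ℝ (Fin d) → ENNReal} (hg : Measurable g) :
    ∫⁻ z, g (matVec A⁻¹ z) = ENNReal.ofReal |A.det| * ∫⁻ x, g x := by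
  have hdet : LinearMap.det (Matrix.toEuclideanLin A⁻¹) = A.det⁻¹ := by
    rw [LinearMap.det_toLpLin, Matrix.det_nonsing_inv, Ring.inverse_eq_inv']
  have h := Measure.map_linearMap_addHaar_eq_smul_addHaar
    (volume : Measure (EuclideanSpace ℝ (Fin d))) (f := Matrix.toEuclideanLin A⁻¹)
    (by rw [hdet]; exact inv_ne_zero hA)
  rw [← lintegral_map hg (measurable_matVec _), matVec_eq_toEuclideanLin, h, hdet,
    lintegral_smul_measure, inv_inv, smul_eq_mul]

theorem lintegral_sphericalUniform {d : ℕ} {h : EuclideanSpace ℝ (Fin d) → ENNReal}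
    (hh : Measurable h) :
    ∫⁻ x, h x ∂sphericalUniform d =
      ((volume : Measure (EuclideanSpace ℝ (Fin d))).toSphere Set.univ)⁻¹ *
        ∫⁻ u : Metric.sphere (0 : EuclideanSpace ℝ (Fin d)) 1, (∫⁻ t in Set.Icc (0 : ℝ) 1,
          h (t • (u : EuclideanSpace ℝ (Fin d))))
            ∂(volume : Measure (EuclideanSpace ℝ (Fin d))).toSphere := by
  have hsf : SFinite (unitSphereUniform d) := by unfold unitSphereUniform; infer_instance
  have hm : Measurable fun p : ℝ × EuclideanSpace ℝ (Fin d) => h (p.1 • p.2) :=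
    hh.comp (by fun_prop)
  rw [sphericalUniform, lintegral_map hh (by fun_prop), lintegral_prod_symm' _ hm,
    unitSphereUniform, lintegral_map hm.lintegral_prod_left' measurable_subtype_coe,
    lintegral_smul_measure, smul_eq_mul]

/-- The law on `(0, ∞)` with unnormalized density `q`. -/
noncomputable def radialLaw (q : ℝ → ℝ) : Measure ℝ :=
  (volume.restrict (Set.Ioi 0)).withDensity
    fun r => ENNReal.ofReal ((∫ s in Set.Ioi (0 : ℝ), q s)⁻¹ * q r)

theorem nullSingletonClass_radialLaw (q : ℝ → ℝ) : NullSingletonClass (radialLaw q) :=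
  ⟨fun x => withDensity_absolutelyContinuous _ _ (measure_singleton x)⟩

theorem radialLaw_apply {q : ℝ → ℝ} (hq0 : ∀ r, 0 < r → 0 ≤ q r)
    (hqi : IntegrableOn q (Set.Ioi 0)) {s : Set ℝ} (hs : MeasurableSet s) :
    radialLaw q s = ENNReal.ofReal
      ((∫ r in Set.Ioi (0 : ℝ), q r)⁻¹ * ∫ r in s ∩ Set.Ioi 0, q r) := by
  have hnn : 0 ≤ ∫ r in Set.Ioi (0 : ℝ), q r := setIntegral_nonneg measurableSet_Ioi hq0
  rw [radialLaw, withDensity_apply _ hs, Measure.restrict_restrict hs, ← integral_const_mul,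
    ofReal_integral_eq_lintegral_ofReal]
  · exact (hqi.mono_set Set.inter_subset_right).const_mul _
  · filter_upwards [ae_restrict_mem (hs.inter measurableSet_Ioi)] with r hr
    exact mul_nonneg (inv_nonneg.2 hnn) (hq0 r hr.2)

theorem isProbabilityMeasure_radialLaw {q : ℝ → ℝ} (hq0 : ∀ r, 0 < r → 0 ≤ q r)
    (hqi : IntegrableOn q (Set.Ioi 0)) (hpos : 0 < ∫ r in Set.Ioi (0 : ℝ), q r) :
    IsProbabilityMeasure (radialLaw q) := by
  refine ⟨?_⟩
  rw [radialLaw_apply hq0 hqi MeasurableSet.univ, Set.univ_inter, inv_mul_cancel₀ hpos.ne',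
    ENNReal.ofReal_one]

theorem cdf_radialLaw {q : ℝ → ℝ} (hq0 : ∀ r, 0 < r → 0 ≤ q r)
    (hqi : IntegrableOn q (Set.Ioi 0)) (hpos : 0 < ∫ r in Set.Ioi (0 : ℝ), q r)
    {r : ℝ} (hr : 0 ≤ r) :
    cdf (radialLaw q) r = (∫ s in Set.Ioi (0 : ℝ), q s)⁻¹ * ∫ s in (0 : ℝ)..r, q s := by
  have := isProbabilityMeasure_radialLaw hq0 hqi hpos
  rw [cdf_eq_real, Measure.real, radialLaw_apply hq0 hqi measurableSet_Iic, Set.Iic_inter_Ioi,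
    ← intervalIntegral.integral_of_le hr, ENNReal.toReal_ofReal]
  rw [intervalIntegral.integral_of_le hr]
  exact mul_nonneg (inv_nonneg.2 hpos.le)
    (setIntegral_nonneg measurableSet_Ioc fun s hs => hq0 s hs.1)

theorem lintegral_comp_cdf_radialLaw {q : ℝ → ℝ} (hqm : Measurable q)
    (hq0 : ∀ r, 0 < r → 0 ≤ q r) (hqi : IntegrableOn q (Set.Ioi 0))
    (hpos : 0 < ∫ r in Set.Ioi (0 : ℝ), q r) {g : ℝ → ENNReal} (hg : Measurable g) :
    ∫⁻ r in Set.Ioi (0 : ℝ), ENNReal.ofReal (q r) * g (cdf (radialLaw q) r) =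
      ENNReal.ofReal (∫ r in Set.Ioi (0 : ℝ), q r) * ∫⁻ t in Set.Icc (0 : ℝ) 1, g t := by
  have := isProbabilityMeasure_radialLaw hq0 hqi hpos
  have := nullSingletonClass_radialLaw q
  have hcm : Measurable (cdf (radialLaw q)) := (monotone_cdf _).measurable
  rw [← map_cdf_eq_restrict_Icc (radialLaw q), lintegral_map hg hcm]
  nth_rewrite 2 [radialLaw]
  rw [lintegral_withDensity_eq_lintegral_mul _ (by fun_prop) (by fun_prop),
    ← lintegral_const_mul _ (by fun_prop)]
  refine lintegral_congr fun r => ?_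
  rw [Pi.mul_apply, ← mul_assoc, ← ENNReal.ofReal_mul hpos.le, mul_inv_cancel_left₀ hpos.ne']

/-- **The elliptical distribution function pushes an elliptical law to `U_d`.**
If `Z` has the elliptical density `f(z) = κ⁻¹ (det Σ)^{-1/2} 𝔣(‖Σ^{-1/2} z‖)` (with
symmetric positive-definite `Σ`, symmetric square root `R = Σ^{1/2}`, radial function `𝔣`
with `0 < μ = ∫_0^∞ r^{d-1}𝔣(r) dr < ∞`, and `κ = ∫_{ℝ^d} 𝔣(‖x‖) dx`), then the map
`z ↦ F*(‖Σ^{-1/2}z‖) · Σ^{-1/2}z/‖Σ^{-1/2}z‖` (with `F*(r) = μ⁻¹ ∫_0^r s^{d-1}𝔣(s) ds`,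
and `0 ↦ 0`) pushes the law of `Z` forward to the spherical uniform distribution `U_d`. -/
theorem elliptical_pushforward_to_sphericalUniform
    (d : ℕ) (hd : 1 ≤ d)
    (Sig R : Matrix (Fin d) (Fin d) ℝ)
    (hSigSymm : Sig.IsSymm) (hSigPos : Sig.PosDef)
    (hRsymm : R.IsSymm) (hRpos : R.PosDef) (hRsq : R * R = Sig)
    (𝔣 : ℝ → ℝ) (h𝔣meas : Measurable 𝔣) (h𝔣nonneg : ∀ r : ℝ, 0 < r → 0 ≤ 𝔣 r)
    (h𝔣int : IntegrableOn (fun r => r ^ (d - 1) * 𝔣 r) (Set.Ioi (0:ℝ)))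
    (h𝔣pos : 0 < ∫ r in Set.Ioi (0:ℝ), r ^ (d - 1) * 𝔣 r)
    (hκint : Integrable (fun x : EuclideanSpace ℝ (Fin d) => 𝔣 ‖x‖)) :
    Measure.map
      (fun z : EuclideanSpace ℝ (Fin d) =>
        ((∫ r in Set.Ioi (0:ℝ), r ^ (d - 1) * 𝔣 r)⁻¹ *
            ∫ s in (0:ℝ)..‖matVec R⁻¹ z‖, s ^ (d - 1) * 𝔣 s) •
          (‖matVec R⁻¹ z‖⁻¹ • matVec R⁻¹ z))
      ((volume : Measure (EuclideanSpace ℝ (Fin d))).withDensity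
        (fun z => ENNReal.ofReal
          ((∫ x : EuclideanSpace ℝ (Fin d), 𝔣 ‖x‖)⁻¹ * (Real.sqrt Sig.det)⁻¹ *
            𝔣 ‖matVec R⁻¹ z‖))) =
      sphericalUniform d := by
  have : Nonempty (Fin d) := ⟨⟨0, hd⟩⟩
  set q : ℝ → ℝ := fun r => r ^ (d - 1) * 𝔣 r
  set κ : ℝ := ∫ x : EuclideanSpace ℝ (Fin d), 𝔣 ‖x‖
  set σ := (volume : Measure (EuclideanSpace ℝ (Fin d))).toSphere
  have hqm : Measurable q := by fun_prop
  have hq0 : ∀ r, 0 < r → 0 ≤ q r := fun r hr => mul_nonneg (pow_nonneg hr.le _) (h𝔣nonneg r hr)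
  have hRdet : 0 < R.det := hRpos.det_pos
  have hdet : Real.sqrt Sig.det = R.det := by
    rw [← hRsq, Matrix.det_mul, Real.sqrt_mul_self hRdet.le]
  have hσ : 0 < σ.real Set.univ :=
    ENNReal.toReal_pos (mt Measure.measure_univ_eq_zero.1 (Measure.toSphere_ne_zero _)) (measure_ne_top _ _)
  have hκ : κ = σ.real Set.univ * ∫ r in Set.Ioi (0 : ℝ), q r := by
    simp only [κ, σ, q, integral_fun_norm_addHaar, Measure.toSphere_real_apply_univ,
      finrank_euclideanSpace, Fintype.card_fin, smul_eq_mul, nsmul_eq_mul, mul_assoc]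
  have hκpos : 0 < κ := hκ ▸ mul_pos hσ h𝔣pos
  have hcm : Measurable (cdf (radialLaw q)) := (monotone_cdf _).measurable
  have hLm := measurable_matVec R⁻¹
  simp_rw [← cdf_radialLaw hq0 h𝔣int h𝔣pos (norm_nonneg _), hdet]
  refine Measure.ext_of_lintegral _ fun h hh => ?_
  have hTm : Measurable fun x : EuclideanSpace ℝ (Fin d) =>
      cdf (radialLaw q) ‖x‖ • (‖x‖⁻¹ • x) := by fun_prop
  rw [lintegral_map hh (by exact hTm.comp hLm),
    lintegral_withDensity_eq_lintegral_mul _ (by fun_prop)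
      (by exact hh.comp (hTm.comp hLm)),
    lintegral_sphericalUniform hh]
  have hstep := lintegral_comp_matVec_inv hRdet.ne' (g := fun x =>
    ENNReal.ofReal (κ⁻¹ * R.det⁻¹ * 𝔣 ‖x‖) * h (cdf (radialLaw q) ‖x‖ • (‖x‖⁻¹ • x)))
    (by fun_prop)
  refine hstep.trans ?_
  rw [lintegral_eq_lintegral_toSphere_Ioi _ (by fun_prop)]
  have hinner : ∀ u : Metric.sphere (0 : EuclideanSpace ℝ (Fin d)) 1,
      ∫⁻ r in Set.Ioi (0 : ℝ), ENNReal.ofReal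
          (r ^ (Module.finrank ℝ (EuclideanSpace ℝ (Fin d)) - 1)) *
        (ENNReal.ofReal (κ⁻¹ * R.det⁻¹ * 𝔣 ‖r • (u : EuclideanSpace ℝ (Fin d))‖) *
          h (cdf (radialLaw q) ‖r • (u : EuclideanSpace ℝ (Fin d))‖ •
            (‖r • (u : EuclideanSpace ℝ (Fin d))‖⁻¹ • (r • (u : EuclideanSpace ℝ (Fin d)))))) =
      ENNReal.ofReal (κ⁻¹ * R.det⁻¹) * (ENNReal.ofReal (∫ r in Set.Ioi (0 : ℝ), q r) *
        ∫⁻ t in Set.Icc (0 : ℝ) 1, h (t • (u : EuclideanSpace ℝ (Fin d)))) := by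
    intro u
    rw [← lintegral_comp_cdf_radialLaw hqm hq0 h𝔣int h𝔣pos
      (g := fun t => h (t • (u : EuclideanSpace ℝ (Fin d)))) (by fun_prop),
      ← lintegral_const_mul _ (by fun_prop)]
    refine setLIntegral_congr_fun measurableSet_Ioi fun r hr => ?_
    have hr : 0 < r := hr
    have hnorm : ‖r • (u : EuclideanSpace ℝ (Fin d))‖ = r := by
      rw [norm_smul, norm_eq_of_mem_sphere, mul_one, Real.norm_of_nonneg hr.le]
    simp only [hnorm, smul_smul, inv_mul_cancel₀ hr.ne', mul_one, finrank_euclideanSpace,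
      Fintype.card_fin]
    rw [← mul_assoc, ← mul_assoc, ← ENNReal.ofReal_mul (by positivity),
      ← ENNReal.ofReal_mul (by positivity)]
    congr 2
    ring
  simp_rw [hinner]
  have hm : Measurable fun u : Metric.sphere (0 : EuclideanSpace ℝ (Fin d)) 1 =>
      ∫⁻ t in Set.Icc (0 : ℝ) 1, h (t • (u : EuclideanSpace ℝ (Fin d))) :=
    Measurable.lintegral_prod_right' (f := fun p :
      Metric.sphere (0 : EuclideanSpace ℝ (Fin d)) 1 × ℝ =>
        h (p.2 • (p.1 : EuclideanSpace ℝ (Fin d)))) (by fun_prop)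
  rw [lintegral_const_mul _ (by fun_prop), lintegral_const_mul _ hm, ← mul_assoc, ← mul_assoc,
    abs_of_pos hRdet, ← ENNReal.ofReal_mul hRdet.le, ← ENNReal.ofReal_mul (by positivity)]
  congr 1
  rw [← ofReal_measureReal (μ := σ) (s := Set.univ), ← ENNReal.ofReal_inv_of_pos hσ, hκ]
  congr 1
  field_simp
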